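/- arXiv:1604.04564 — 2 statements merged into one kernel-verified Lean document; each statement's English description precedes it below -/
import Mathlib

section
/- Let 𝒪 be an order in a product of m number fields K = K₁ × ⋯ × K_m. Then the unit group 𝒪^× is a finitely generated abelian group of rank r = r₁ + r₂ − m. -/
set_option maxHeartbeats 1000000
set_option synthInstance.maxHeartbeats 400000

noncomputable section

open NumberField Filter Topology

/-- An injective homomorphism of abelian groups whose cokernel has finite exponent preserves
the rank. -/
theorem finrank_eq_of_injective_of_nsmul_mem_range {G A : Type*} [AddCommGroup G] [AddCommGroup A]
    [Module.Finite ℤ A] (f : G →ₗ[ℤ] A) (hf : Function.Injective f) {e : ℕ} (he : 0 < e)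
    (h : ∀ a, e • a ∈ LinearMap.range f) : Module.finrank ℤ G = Module.finrank ℤ A := by
  have htors : Module.IsTorsion ℤ (A ⧸ LinearMap.range f) := by
    intro q
    obtain ⟨a, rfl⟩ := Submodule.Quotient.mk_surjective _ q
    refine ⟨⟨(e : ℤ), mem_nonZeroDivisors_of_ne_zero (by exact_mod_cast he.ne')⟩, ?_⟩
    change (e : ℤ) • (Submodule.Quotient.mk a : A ⧸ LinearMap.range f) = _
    rw [← Submodule.Quotient.mk_smul, Submodule.Quotient.mk_eq_zero, natCast_zsmul]
    exact h a
  have hsum := Submodule.finrank_quotient_add_finrank (LinearMap.range f)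
  rw [htors.finrank_eq_zero, zero_add, LinearMap.finrank_range_of_inj hf] at hsum
  exact hsum

theorem finrank_pi_of_isDomain {R ι : Type*} [CommRing R] [IsDomain R] [IsPrincipalIdealRing R]
    [Fintype ι] (M : ι → Type*) [∀ i, AddCommGroup (M i)] [∀ i, Module R (M i)]
    [∀ i, Module.Finite R (M i)] :
    Module.finrank R (Π i, M i) = ∑ i, Module.finrank R (M i) := by
  classical
  have hle : Submodule.pi Set.univ (fun i ↦ Submodule.torsion R (M i)) ≤
      Submodule.torsion R (Π i, M i) := by
    intro x hx
    have hx' : ∀ i, ∃ a : nonZeroDivisors R, a • x i = 0 := fun i ↦ hx i trivial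
    choose a ha using hx'
    refine ⟨∏ i, a i, funext fun i ↦ ?_⟩
    rw [← Finset.prod_erase_mul _ _ (Finset.mem_univ i), mul_smul, Pi.smul_apply, Pi.smul_apply,
      ha, smul_zero, Pi.zero_apply]
  rw [← finrank_quotient_eq_of_le_torsion hle, (Submodule.quotientPi _).finrank_eq,
    Module.finrank_pi_fintype]
  exact Finset.sum_congr rfl fun i _ ↦ finrank_quotient_eq_of_le_torsion le_rfl

/-- If a subring of a commutative ring `R`, finite over `ℤ`, contains `N R` for some `N > 0`,
then a fixed power of every unit of `R` is a unit of the subring. -/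
theorem exists_units_pow_mem_range {S R : Type*} [CommRing S] [CommRing R] [Module.Finite ℤ R]
    (f : S →+* R) (hf : Function.Injective f) {N : ℕ} (hN : 0 < N)
    (h : ∀ x : R, N • x ∈ f.range) :
    ∃ e : ℕ, 0 < e ∧ ∀ u : Rˣ, u ^ e ∈ (Units.map (f : S →* R)).range := by
  let I : Ideal R := Ideal.span {(N : R)}
  have htors : Module.IsTorsion ℤ (R ⧸ I) := by
    intro q
    obtain ⟨a, rfl⟩ := Ideal.Quotient.mk_surjective q
    refine ⟨⟨(N : ℤ), mem_nonZeroDivisors_of_ne_zero (by exact_mod_cast hN.ne')⟩, ?_⟩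
    change (N : ℤ) • Ideal.Quotient.mk I a = _
    rw [← map_zsmul, Ideal.Quotient.eq_zero_iff_mem, natCast_zsmul, nsmul_eq_mul]
    exact I.mul_mem_right _ (Ideal.mem_span_singleton_self _)
  have : Module.Finite ℤ (R ⧸ I) :=
    Module.Finite.of_surjective (Ideal.Quotient.mk I).toAddMonoidHom.toIntLinearMap
      Ideal.Quotient.mk_surjective
  have : Finite (R ⧸ I) := Module.finite_of_fg_torsion _ htors
  have hmem : ∀ u : Rˣ, ((u ^ Nat.card (R ⧸ I)ˣ : Rˣ) : R) ∈ f.range := by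
    intro u
    have h1 : Units.map (Ideal.Quotient.mk I : R →* R ⧸ I) u ^ Nat.card (R ⧸ I)ˣ = 1 :=
      pow_card_eq_one' (G := (R ⧸ I)ˣ)
    have h2 : Ideal.Quotient.mk I ((u ^ Nat.card (R ⧸ I)ˣ : Rˣ) : R) = Ideal.Quotient.mk I 1 := by
      rw [Units.val_pow_eq_pow_val, map_pow, map_one]
      exact congrArg Units.val h1
    obtain ⟨c, hc⟩ := Ideal.mem_span_singleton'.mp (Ideal.Quotient.eq.mp h2)
    rw [← sub_add_cancel ((u ^ Nat.card (R ⧸ I)ˣ : Rˣ) : R) 1, ← hc, mul_comm, ← nsmul_eq_mul]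
    exact add_mem (h c) (one_mem _)
  refine ⟨Nat.card (R ⧸ I)ˣ, Nat.card_pos, fun u ↦ ?_⟩
  obtain ⟨a, ha⟩ := hmem u
  obtain ⟨b, hb⟩ := hmem u⁻¹
  have hab : a * b = 1 := hf (by rw [map_mul, ha, hb, ← Units.val_mul, ← mul_pow]; simp)
  exact ⟨⟨a, b, hab, by rw [mul_comm, hab]⟩, Units.ext ha⟩

/-- A ring homomorphism from a finite product of rings to a domain factors through a unique
projection. -/
theorem bijective_comp_evalRingHom {ι : Type*} [Fintype ι] (K : ι → Type*) [∀ i, CommRing (K i)]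
    (L : Type*) [CommRing L] [IsDomain L] :
    Function.Bijective fun p : Σ i, K i →+* L ↦ p.2.comp (Pi.evalRingHom K p.1) := by
  classical
  constructor
  · rintro ⟨i, φ⟩ ⟨j, ψ⟩ h
    have h' : ∀ x : Π i, K i, φ (x i) = ψ (x j) := fun x ↦ RingHom.congr_fun h x
    obtain rfl : i = j := by
      by_contra hij
      simpa [Pi.single_eq_of_ne (Ne.symm hij)] using h' (Pi.single i 1)
    congr 1
    ext x
    simpa using h' (Pi.single i x)
  · intro f
    obtain ⟨i, hi⟩ : ∃ i, f (Pi.single i 1) ≠ 0 := by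
      by_contra! hall
      have h1 : ∑ i, (Pi.single i 1 : Π i, K i) = 1 := Finset.univ_sum_single 1
      simpa [hall] using congrArg f h1
    have hone : f (Pi.single i 1) = 1 := by
      refine mul_left_cancel₀ hi ?_
      rw [← map_mul, ← Pi.single_mul, mul_one, mul_one]
    refine ⟨⟨i, {
      toFun := fun x ↦ f (Pi.single i x)
      map_one' := hone
      map_zero' := by simp
      map_mul' := fun x y ↦ by rw [Pi.single_mul, map_mul]
      map_add' := fun x y ↦ by rw [Pi.single_add, map_add] }⟩, ?_⟩
    refine RingHom.ext fun x ↦ ?_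
    change f (Pi.single i (x i)) = f x
    rw [← mul_one (f x), ← hone, ← map_mul]
    congr 1
    ext j
    obtain rfl | hj := eq_or_ne j i
    · simp
    · simp [Pi.single_eq_of_ne hj]

theorem card_ringHom_pi {ι : Type*} [Fintype ι] (K : ι → Type*) [∀ i, CommRing (K i)]
    (L : Type*) [CommRing L] [IsDomain L] [∀ i, Finite (K i →+* L)] :
    Nat.card ((Π i, K i) →+* L) = ∑ i, Nat.card (K i →+* L) := by
  rw [← Nat.card_eq_of_bijective _ (bijective_comp_evalRingHom K L), Nat.card_sigma]

/-- Homomorphisms to `ℝ` are the same as real complex embeddings. -/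
theorem bijective_codRestrict_ofRealHom (K : Type*) [Field K] :
    Function.Bijective fun φ : K →+* ℝ ↦
      (⟨Complex.ofRealHom.comp φ, RingHom.ext fun x ↦ Complex.conj_ofReal (φ x)⟩ :
        { φ : K →+* ℂ // ComplexEmbedding.IsReal φ }) := by
  constructor
  · intro φ ψ h
    ext x
    exact Complex.ofReal_injective (RingHom.congr_fun (congrArg Subtype.val h) x)
  · rintro ⟨φ, hφ⟩
    exact ⟨hφ.embedding, Subtype.ext (RingHom.ext fun x ↦ hφ.coe_embedding_apply x)⟩

instance finite_ringHom_real (K : Type*) [Field K] [NumberField K] : Finite (K →+* ℝ) :=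
  Finite.of_injective _ (bijective_codRestrict_ofRealHom K).injective

theorem card_ringHom_real (K : Type*) [Field K] [NumberField K] :
    Nat.card (K →+* ℝ) = InfinitePlace.nrRealPlaces K := by
  classical
  rw [Nat.card_eq_of_bijective _ (bijective_codRestrict_ofRealHom K), Nat.card_eq_fintype_card,
    InfinitePlace.card_real_embeddings]

theorem card_ringHom_complex (K : Type*) [Field K] [NumberField K] :
    Nat.card (K →+* ℂ) = InfinitePlace.nrRealPlaces K + 2 * InfinitePlace.nrComplexPlaces K := by
  rw [InfinitePlace.card_add_two_mul_card_eq_rank, Nat.card_eq_fintype_card, Embeddings.card]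

theorem rank_add_one (K : Type*) [Field K] [NumberField K] :
    Units.rank K + 1 = InfinitePlace.nrRealPlaces K + InfinitePlace.nrComplexPlaces K := by
  rw [← InfinitePlace.card_eq_nrRealPlaces_add_nrComplexPlaces, Units.rank]
  exact Nat.sub_add_cancel Fintype.card_pos

/-- The units of the maximal order of a product of number fields, written additively. -/
def unitsPiRingOfIntegersEquiv {ι : Type*} (K : ι → Type*) [∀ i, Field (K i)] :
    Additive (Π i, 𝓞 (K i))ˣ ≃ₗ[ℤ] Π i, Additive (𝓞 (K i))ˣ :=
  AddEquiv.toIntLinearEquiv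
    { toFun := fun u i ↦ Additive.ofMul (MulEquiv.piUnits u.toMul i)
      invFun := fun v ↦ Additive.ofMul (MulEquiv.piUnits.symm fun i ↦ (v i).toMul)
      left_inv := fun _ ↦ rfl
      right_inv := fun _ ↦ rfl
      map_add' := fun _ _ ↦ rfl }

/-- The inclusion of an order in a product of number fields into the maximal order. -/
def orderToRingOfIntegers {ι : Type*} (K : ι → Type*) [∀ i, Field (K i)]
    (O : Subalgebra ℤ (Π i, K i)) [Module.Finite ℤ O] : O →+* Π i, 𝓞 (K i) :=
  RingHom.pi fun i ↦ ((Pi.evalRingHom K i).comp O.val.toRingHom).codRestrict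
    (integralClosure ℤ (K i)) fun x ↦
      (Algebra.IsIntegral.isIntegral (R := ℤ) x).map ((Pi.evalAlgHom ℤ K i).comp O.val)

theorem orderToRingOfIntegers_apply {ι : Type*} (K : ι → Type*) [∀ i, Field (K i)]
    (O : Subalgebra ℤ (Π i, K i)) [Module.Finite ℤ O] (x : O) (i : ι) :
    (orderToRingOfIntegers K O x i : K i) = (x : Π i, K i) i := rfl

theorem orderToRingOfIntegers_injective {ι : Type*} (K : ι → Type*) [∀ i, Field (K i)]
    (O : Subalgebra ℤ (Π i, K i)) [Module.Finite ℤ O] :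
    Function.Injective (orderToRingOfIntegers K O) := by
  intro x y h
  ext i
  rw [← orderToRingOfIntegers_apply, h, orderToRingOfIntegers_apply]

theorem exists_nsmul_mem_range_orderToRingOfIntegers {ι : Type*} [Finite ι] (K : ι → Type*)
    [∀ i, Field (K i)] [∀ i, NumberField (K i)] (O : Subalgebra ℤ (Π i, K i)) [Module.Finite ℤ O]
    (hK : ∀ x : Π i, K i, ∃ n : ℕ, 0 < n ∧ n • x ∈ O) :
    ∃ N : ℕ, 0 < N ∧ ∀ x, N • x ∈ (orderToRingOfIntegers K O).range := by
  let M := LinearMap.range (orderToRingOfIntegers K O).toAddMonoidHom.toIntLinearMap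
  have htors : Module.IsTorsion ℤ ((Π i, 𝓞 (K i)) ⧸ M) := by
    intro q
    obtain ⟨a, rfl⟩ := Submodule.Quotient.mk_surjective _ q
    obtain ⟨n, hn, hmem⟩ := hK fun i ↦ a i
    refine ⟨⟨(n : ℤ), mem_nonZeroDivisors_of_ne_zero (by exact_mod_cast hn.ne')⟩, ?_⟩
    change (n : ℤ) • (Submodule.Quotient.mk a : _ ⧸ M) = _
    rw [← Submodule.Quotient.mk_smul, Submodule.Quotient.mk_eq_zero, natCast_zsmul]
    refine ⟨⟨_, hmem⟩, ?_⟩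
    ext i
    change n • (a i : K i) = ((n • a i : 𝓞 (K i)) : K i)
    simp
  have : Finite ((Π i, 𝓞 (K i)) ⧸ M) := Module.finite_of_fg_torsion _ htors
  refine ⟨Nat.card ((Π i, 𝓞 (K i)) ⧸ M), Nat.card_pos, fun x ↦ ?_⟩
  have hx : Nat.card ((Π i, 𝓞 (K i)) ⧸ M) • x ∈ M := by
    rw [← Submodule.Quotient.mk_eq_zero, Submodule.Quotient.mk_smul]
    exact card_nsmul_eq_zero'
  exact hx

/-- Dirichlet unit theorem for orders: the unit group of an order `𝒪` in a product of `m`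
number fields is finitely generated of rank `r₁ + r₂ - m`, where `r₁` is the number of ring
homomorphisms `K → ℝ` and `r₂` the number of conjugate pairs of complex embeddings. -/
theorem stmt1 {m : ℕ} (K : Fin m → Type) [∀ i, Field (K i)] [∀ i, NumberField (K i)]
    (O : Subalgebra ℤ (Π i, K i)) (hfg : Module.Finite ℤ ↥O)
    (hK : ∀ x : Π i, K i, ∃ n : ℕ, 0 < n ∧ n • x ∈ O) :
    Group.FG (↥O)ˣ ∧
      Module.finrank ℤ (Additive ((↥O)ˣ ⧸ CommGroup.torsion (↥O)ˣ)) =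
        Nat.card ((Π i, K i) →+* ℝ) +
          (Nat.card ((Π i, K i) →+* ℂ) - Nat.card ((Π i, K i) →+* ℝ)) / 2 - m := by
  let f := orderToRingOfIntegers K O
  have hf : Function.Injective f := orderToRingOfIntegers_injective K O
  obtain ⟨N, hN, hNmem⟩ := exists_nsmul_mem_range_orderToRingOfIntegers K O hK
  obtain ⟨e, he, hemem⟩ := exists_units_pow_mem_range f hf hN hNmem
  let g : Additive (↥O)ˣ →ₗ[ℤ] Additive (Π i, 𝓞 (K i))ˣ :=
    (MonoidHom.toAdditive (Units.map (f : ↥O →* Π i, 𝓞 (K i)))).toIntLinearMap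
  have hg : Function.Injective g := Units.map_injective hf
  have hfin : Module.Finite ℤ (Additive (Π i, 𝓞 (K i))ˣ) :=
    Module.Finite.equiv (unitsPiRingOfIntegersEquiv K).symm
  have hfinO : Module.Finite ℤ (Additive (↥O)ˣ) := Module.Finite.of_injective g hg
  refine ⟨?_, ?_⟩
  · rw [Group.fg_iff_monoid_fg, Monoid.fg_iff_add_fg, ← AddGroup.fg_iff_addMonoid_fg,
      ← Module.Finite.iff_addGroup_fg]
    exact hfinO
  have hrank : Module.finrank ℤ (Additive ((↥O)ˣ ⧸ CommGroup.torsion (↥O)ˣ)) =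
      ∑ i, Units.rank (K i) := by
    have hquot : Module.finrank ℤ (Additive ((↥O)ˣ ⧸ CommGroup.torsion (↥O)ˣ)) =
        Module.finrank ℤ (Additive (↥O)ˣ) :=
      finrank_quotient_torsion_eq (M := Additive (↥O)ˣ)
    rw [hquot, finrank_eq_of_injective_of_nsmul_mem_range g hg he fun a ↦ hemem a.toMul,
      (unitsPiRingOfIntegersEquiv K).finrank_eq, finrank_pi_of_isDomain]
    exact Finset.sum_congr rfl fun i _ ↦ Units.finrank_eq (K i)
  have hsum := Finset.sum_congr rfl fun i (_ : i ∈ Finset.univ) ↦ rank_add_one (K i)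
  simp only [Finset.sum_add_distrib, Finset.sum_const, Finset.card_univ, Fintype.card_fin,
    smul_eq_mul, mul_one] at hsum
  rw [hrank, card_ringHom_pi, card_ringHom_pi]
  simp only [card_ringHom_real, card_ringHom_complex, Finset.sum_add_distrib, ← Finset.mul_sum]
  rw [Nat.add_sub_cancel_left, Nat.mul_div_cancel_left _ two_pos]
  exact Nat.eq_sub_of_add_eq hsum

end
end

section
/- Let 𝒪 be an order in a product of number fields K with normalization 𝒪̃. Then as real s → 1⁺, the ratio ζ_𝒪̃(s)/ζ_𝒪(s) tends to ∏_𝔭 [ ∏_{𝔓 | 𝔭} (1 − N𝔓^{−1})^{−1} ] / (1 − N𝔭^{−1})^{−1}, where the outer product is over all maximal ideals 𝔭 of 𝒪 and all but finitely many of its factors equal 1. -/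
set_option maxHeartbeats 1000000
set_option synthInstance.maxHeartbeats 400000

noncomputable section

open NumberField Filter Topology

/-- The zeta function of a (finite-type) commutative ring, defined for real `s` as the Euler
product `∏_𝔭 (1 - N𝔭^{-s})⁻¹` over all maximal ideals `𝔭`, where `N𝔭 = #(R/𝔭)`. -/
noncomputable def zetaOrder (R : Type) [CommRing R] (s : ℝ) : ℝ :=
  ∏' 𝔭 : MaximalSpectrum R, (1 - (Nat.card (R ⧸ 𝔭.asIdeal) : ℝ) ^ (-s))⁻¹

namespace MaximalSpectrum

section FiniteOverInt

variable (A : Type) [CommRing A] [Module.Finite ℤ A]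

theorem exists_card_quotient_span_natCast_le :
    ∃ n : ℕ, ∀ k : ℕ, 0 < k → Finite (A ⧸ Ideal.span {(k : A)}) ∧
      Nat.card (A ⧸ Ideal.span {(k : A)}) ≤ k ^ n := by
  obtain ⟨n, φ, hφ⟩ := Module.Finite.exists_fin' ℤ A
  refine ⟨n, fun k hk => ?_⟩
  have : NeZero k := ⟨hk.ne'⟩
  let g : (Fin n → ZMod k) → A ⧸ Ideal.span {(k : A)} :=
    fun a => Ideal.Quotient.mk _ (φ fun i => (a i).cast)
  have hg : Function.Surjective g := by
    intro y
    obtain ⟨x, rfl⟩ := Ideal.Quotient.mk_surjective y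
    obtain ⟨v, rfl⟩ := hφ x
    refine ⟨fun i => (v i : ZMod k), ?_⟩
    have hdvd : ∀ i, ∃ w : ℤ, ((v i : ZMod k).cast : ℤ) - v i = k * w := by
      intro i
      have h : (k : ℤ) ∣ ((v i : ZMod k).cast : ℤ) - v i := by
        rw [← ZMod.intCast_zmod_eq_zero_iff_dvd]
        simp
      exact h
    choose w hw using hdvd
    refine (Ideal.Quotient.mk_eq_mk_iff_sub_mem _ _).mpr ?_
    rw [← map_sub, Ideal.mem_span_singleton]
    refine ⟨φ w, ?_⟩
    have : (fun i => ((v i : ZMod k).cast : ℤ)) - v = (k : ℤ) • w := by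
      ext i
      simpa using hw i
    rw [this, map_smul]
    simp
  refine ⟨Finite.of_surjective g hg, ?_⟩
  simpa using Nat.card_le_card_of_surjective g hg

variable {A}

theorem exists_prime_natCast_mem (𝔪 : MaximalSpectrum A) :
    ∃ p : ℕ, p.Prime ∧ (p : A) ∈ 𝔪.asIdeal := by
  have := 𝔪.isMaximal
  have hmax : (Ideal.comap (algebraMap ℤ A) 𝔪.asIdeal).IsMaximal :=
    Ideal.isMaximal_comap_of_isIntegral_of_isMaximal 𝔪.asIdeal
  have hne : Ideal.comap (algebraMap ℤ A) 𝔪.asIdeal ≠ ⊥ := by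
    intro h
    rw [h] at hmax
    exact Int.not_isField (Ring.isField_iff_maximal_bot.mpr hmax)
  obtain ⟨a, ha⟩ := (IsPrincipalIdealRing.principal (Ideal.comap (algebraMap ℤ A) 𝔪.asIdeal))
  have ha' : Ideal.comap (algebraMap ℤ A) 𝔪.asIdeal = Ideal.span {a} := ha
  have ha0 : a ≠ 0 := by
    rintro rfl
    exact hne (by simpa using ha')
  have hp : Prime a := by
    rw [← Ideal.span_singleton_prime ha0, ← ha']
    exact hmax.isPrime
  refine ⟨a.natAbs, Int.prime_iff_natAbs_prime.mp hp, ?_⟩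
  have h : (a.natAbs : ℤ) ∈ Ideal.comap (algebraMap ℤ A) 𝔪.asIdeal := by
    rw [ha', Ideal.mem_span_singleton]
    exact Int.dvd_natAbs.mpr dvd_rfl
  rwa [Ideal.mem_comap, map_natCast] at h

theorem finite_quotient_of_natCast_mem {I : Ideal A} {k : ℕ} (hk : 0 < k) (h : (k : A) ∈ I) :
    Finite (A ⧸ I) := by
  obtain ⟨n, hn⟩ := exists_card_quotient_span_natCast_le A
  have := (hn k hk).1
  exact Finite.of_surjective
    (Ideal.Quotient.factor ((Ideal.span_singleton_le_iff_mem I).mpr h))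
    (Ideal.Quotient.factor_surjective _)

theorem le_card_quotient_of_natCast_mem (𝔪 : MaximalSpectrum A) {p : ℕ} (hp : p.Prime)
    (h : (p : A) ∈ 𝔪.asIdeal) : p ≤ Nat.card (A ⧸ 𝔪.asIdeal) := by
  have := finite_quotient_of_natCast_mem hp.pos h
  have := Fact.mk hp
  have : Nontrivial (A ⧸ 𝔪.asIdeal) := Ideal.Quotient.nontrivial_iff.mpr 𝔪.isMaximal.ne_top
  have h1 : addOrderOf (1 : A ⧸ 𝔪.asIdeal) = p := by
    refine addOrderOf_eq_prime ?_ one_ne_zero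
    rw [nsmul_eq_mul, mul_one]
    simpa using Ideal.Quotient.eq_zero_iff_mem.mpr h
  refine Nat.le_of_dvd Nat.card_pos ?_
  rw [← h1]
  exact addOrderOf_dvd_natCard _

theorem two_le_card_quotient (𝔪 : MaximalSpectrum A) : 2 ≤ Nat.card (A ⧸ 𝔪.asIdeal) := by
  obtain ⟨p, hp, h⟩ := exists_prime_natCast_mem 𝔪
  exact hp.two_le.trans (le_card_quotient_of_natCast_mem 𝔪 hp h)

theorem finite_setOf_natCast_mem {k : ℕ} (hk : 0 < k) :
    {𝔪 : MaximalSpectrum A | (k : A) ∈ 𝔪.asIdeal}.Finite := by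
  have : Finite (A ⧸ Ideal.span {(k : A)}) :=
    finite_quotient_of_natCast_mem hk (Ideal.mem_span_singleton_self _)
  refine Set.Finite.of_finite_image
    (f := fun 𝔪 => Ideal.map (Ideal.Quotient.mk (Ideal.span {(k : A)})) 𝔪.asIdeal)
    (Set.toFinite _) ?_
  intro 𝔪 h𝔪 𝔫 h𝔫 h
  have key : ∀ 𝔮 : MaximalSpectrum A, (k : A) ∈ 𝔮.asIdeal →
      Ideal.comap (Ideal.Quotient.mk (Ideal.span {(k : A)}))
        (Ideal.map (Ideal.Quotient.mk (Ideal.span {(k : A)})) 𝔮.asIdeal) = 𝔮.asIdeal := by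
    intro 𝔮 h𝔮
    rw [Ideal.comap_map_of_surjective' _ Ideal.Quotient.mk_surjective, Ideal.mk_ker]
    exact sup_eq_left.mpr ((Ideal.span_singleton_le_iff_mem _).mpr h𝔮)
  ext1
  rw [← key 𝔪 h𝔪, ← key 𝔫 h𝔫]
  exact congrArg _ h

variable (A) in
theorem exists_card_le_of_prime_mem :
    ∃ n : ℕ, ∀ p : ℕ, p.Prime → ∀ F : Finset (MaximalSpectrum A),
      (∀ 𝔪 ∈ F, (p : A) ∈ 𝔪.asIdeal) → F.card ≤ n := by
  obtain ⟨n, hn⟩ := exists_card_quotient_span_natCast_le A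
  refine ⟨n, fun p hp F hF => ?_⟩
  have := (hn p hp.pos).1
  have hcop : Pairwise (Function.onFun IsCoprime fun 𝔪 : F => 𝔪.1.asIdeal) := by
    intro 𝔪 𝔫 hne
    have := 𝔪.1.isMaximal
    have := 𝔫.1.isMaximal
    refine Ideal.isCoprime_of_isMaximal fun h => hne ?_
    exact Subtype.ext (MaximalSpectrum.ext h)
  have e := Ideal.quotientInfRingEquivPiQuotient (fun 𝔪 : F => 𝔪.1.asIdeal) hcop
  have hle : Ideal.span {(p : A)} ≤ ⨅ 𝔪 : F, 𝔪.1.asIdeal := by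
    rw [Ideal.span_singleton_le_iff_mem, Ideal.mem_iInf]
    exact fun 𝔪 => hF 𝔪.1 𝔪.2
  have hcard := Nat.card_le_card_of_surjective
    (fun x => e (Ideal.Quotient.factor hle x))
    (e.surjective.comp (Ideal.Quotient.factor_surjective hle))
  rw [Nat.card_pi] at hcard
  have hprod : p ^ F.card ≤ ∏ 𝔪 : F, Nat.card (A ⧸ 𝔪.1.asIdeal) := by
    calc p ^ F.card = ∏ _𝔪 : F, p := by simp
      _ ≤ _ := Finset.prod_le_prod' fun 𝔪 _ =>
        le_card_quotient_of_natCast_mem 𝔪.1 hp (hF 𝔪.1 𝔪.2)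
  exact (Nat.pow_le_pow_iff_right hp.one_lt).mp (hprod.trans (hcard.trans (hn p hp.pos).2))

theorem card_quotient_rpow_neg_le_half (𝔪 : MaximalSpectrum A) {s : ℝ} (hs : 1 ≤ s) :
    (Nat.card (A ⧸ 𝔪.asIdeal) : ℝ) ^ (-s) ≤ 1 / 2 := by
  have h2 : (2 : ℝ) ≤ Nat.card (A ⧸ 𝔪.asIdeal) := by exact_mod_cast two_le_card_quotient 𝔪
  calc (Nat.card (A ⧸ 𝔪.asIdeal) : ℝ) ^ (-s) ≤ (Nat.card (A ⧸ 𝔪.asIdeal) : ℝ) ^ (-1 : ℝ) :=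
        Real.rpow_le_rpow_of_exponent_le (by linarith) (by linarith)
    _ ≤ 2 ^ (-1 : ℝ) := Real.rpow_le_rpow_of_nonpos (by norm_num) h2 (by norm_num)
    _ = 1 / 2 := by rw [Real.rpow_neg_one]; norm_num

theorem summable_card_quotient_rpow {s : ℝ} (hs : 1 < s) :
    Summable fun 𝔪 : MaximalSpectrum A => (Nat.card (A ⧸ 𝔪.asIdeal) : ℝ) ^ (-s) := by
  obtain ⟨n, hn⟩ := exists_card_le_of_prime_mem A
  choose p hp hmem using exists_prime_natCast_mem (A := A)
  have hfib : ∀ q : ℕ, ∃ g : {𝔪 : MaximalSpectrum A // p 𝔪 = q} → Fin n,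
      Function.Injective g := by
    intro q
    by_cases hq : q.Prime
    · have hfin : Finite {𝔪 : MaximalSpectrum A // p 𝔪 = q} :=
        ((finite_setOf_natCast_mem hq.pos).subset
          (fun 𝔪 (h : p 𝔪 = q) => by rw [← h]; exact hmem 𝔪) :
          {𝔪 : MaximalSpectrum A | p 𝔪 = q}.Finite)
      have := Fintype.ofFinite {𝔪 : MaximalSpectrum A // p 𝔪 = q}
      have hc : Fintype.card {𝔪 : MaximalSpectrum A // p 𝔪 = q} ≤ n := by
        have := hn q hq (Finset.univ.map (Function.Embedding.subtype fun 𝔪 => p 𝔪 = q))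
          (by
            intro 𝔪 h𝔪
            simp only [Finset.mem_map, Finset.mem_univ, true_and] at h𝔪
            obtain ⟨⟨𝔪, rfl⟩, rfl⟩ := h𝔪
            exact hmem 𝔪)
        simpa using this
      obtain ⟨g⟩ := Function.Embedding.nonempty_of_card_le
        (hc.trans (Fintype.card_fin n).ge)
      exact ⟨g, g.injective⟩
    · have : IsEmpty {𝔪 : MaximalSpectrum A // p 𝔪 = q} :=
        ⟨fun 𝔪 => hq (𝔪.2 ▸ hp 𝔪.1)⟩
      exact ⟨isEmptyElim, fun a => isEmptyElim a⟩
  choose g hg using hfib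
  have hinj : Function.Injective
      fun 𝔪 : MaximalSpectrum A => ((p 𝔪, g (p 𝔪) ⟨𝔪, rfl⟩) : ℕ × Fin n) := by
    intro 𝔪 𝔫 h
    obtain ⟨h1, h2⟩ := Prod.ext_iff.mp h
    dsimp only at h1 h2
    have aux : ∀ (q : ℕ) (h : p 𝔫 = q), g q ⟨𝔫, h⟩ = g (p 𝔫) ⟨𝔫, rfl⟩ := by
      rintro _ rfl; rfl
    rw [← aux _ h1.symm] at h2
    exact congrArg Subtype.val (hg _ h2)
  have hsum : Summable fun x : ℕ × Fin n => (x.1 : ℝ) ^ (-s) * (1 : ℝ) :=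
    Summable.mul_of_nonneg (f := fun k : ℕ => (k : ℝ) ^ (-s)) (g := fun _ : Fin n => (1 : ℝ))
      (Real.summable_nat_rpow.mpr (by linarith)) (Summable.of_finite)
      (fun k => by positivity) (fun _ => zero_le_one)
  refine Summable.of_nonneg_of_le (fun 𝔪 => by positivity) (fun 𝔪 => ?_)
    (hsum.comp_injective hinj)
  simp only [Function.comp_apply, mul_one]
  exact Real.rpow_le_rpow_of_nonpos (by exact_mod_cast (hp 𝔪).pos)
    (by exact_mod_cast le_card_quotient_of_natCast_mem 𝔪 (hp 𝔪) (hmem 𝔪)) (by linarith)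

theorem multipliable_eulerFactor {s : ℝ} (hs : 1 < s) :
    Multipliable fun 𝔪 : MaximalSpectrum A =>
      (1 - (Nat.card (A ⧸ 𝔪.asIdeal) : ℝ) ^ (-s))⁻¹ := by
  have hsum : Summable fun 𝔪 : MaximalSpectrum A =>
      (1 - (Nat.card (A ⧸ 𝔪.asIdeal) : ℝ) ^ (-s))⁻¹ - 1 := by
    refine Summable.of_nonneg_of_le (fun 𝔪 => ?_) (fun 𝔪 => ?_)
      ((summable_card_quotient_rpow hs).mul_left 2)
    all_goals
      have h0 : 0 ≤ (Nat.card (A ⧸ 𝔪.asIdeal) : ℝ) ^ (-s) := by positivity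
      have h1 := card_quotient_rpow_neg_le_half 𝔪 hs.le
      set x := (Nat.card (A ⧸ 𝔪.asIdeal) : ℝ) ^ (-s)
      have h2 : (1 - x)⁻¹ - 1 = x / (1 - x) := by
        have : 1 - x ≠ 0 := by linarith
        field_simp
        ring
      rw [h2]
    · exact div_nonneg h0 (by linarith)
    · rw [div_le_iff₀ (by linarith)]
      nlinarith
  simpa using Real.multipliable_one_add_of_summable hsum

theorem one_le_eulerFactor (𝔪 : MaximalSpectrum A) {s : ℝ} (hs : 1 ≤ s) :
    1 ≤ (1 - (Nat.card (A ⧸ 𝔪.asIdeal) : ℝ) ^ (-s))⁻¹ := by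
  have h0 : 0 ≤ (Nat.card (A ⧸ 𝔪.asIdeal) : ℝ) ^ (-s) := by positivity
  have h1 := card_quotient_rpow_neg_le_half 𝔪 hs
  exact (one_le_inv₀ (by linarith)).mpr (by linarith)

theorem one_le_zetaOrder {s : ℝ} (hs : 1 < s) : 1 ≤ zetaOrder A s :=
  ge_of_tendsto' (multipliable_eulerFactor hs).hasProd fun F => by
    simpa using Finset.prod_le_prod (s := F) (f := fun _ => (1 : ℝ))
      (fun _ _ => zero_le_one) fun 𝔪 _ => one_le_eulerFactor 𝔪 hs.le

theorem continuousAt_eulerFactor (𝔪 : MaximalSpectrum A) :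
    ContinuousAt (fun s : ℝ => (1 - (Nat.card (A ⧸ 𝔪.asIdeal) : ℝ) ^ (-s))⁻¹) 1 := by
  have h2 := two_le_card_quotient 𝔪
  have h1 := card_quotient_rpow_neg_le_half 𝔪 le_rfl
  refine ContinuousAt.inv₀ ?_ (by linarith)
  refine continuousAt_const.sub (ContinuousAt.rpow continuousAt_const continuousAt_neg ?_)
  left
  exact_mod_cast (by omega : Nat.card (A ⧸ 𝔪.asIdeal) ≠ 0)

end FiniteOverInt

section Extension

variable {R S : Type} [CommRing R] [CommRing S] (f : R →+* S)

/-- The quotient of the Euler factors at `s` of `S` above `𝔭` by the Euler factor of `R` at `𝔭`. -/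
def localZetaRatio (s : ℝ) (𝔭 : MaximalSpectrum R) : ℝ :=
  (∏' 𝔓 : {𝔓 : MaximalSpectrum S // Ideal.comap f 𝔓.asIdeal = 𝔭.asIdeal},
    (1 - (Nat.card (S ⧸ 𝔓.1.asIdeal) : ℝ) ^ (-s))⁻¹) /
  (1 - (Nat.card (R ⧸ 𝔭.asIdeal) : ℝ) ^ (-s))⁻¹

theorem card_quotient_eq_of_comap_eq {N : ℕ}
    (hN : ∀ x : S, ∃ r : R, f r = N * x) {𝔭 : MaximalSpectrum R} (h𝔭 : (N : R) ∉ 𝔭.asIdeal)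
    {𝔓 : MaximalSpectrum S} (h : Ideal.comap f 𝔓.asIdeal = 𝔭.asIdeal) :
    Nat.card (S ⧸ 𝔓.asIdeal) = Nat.card (R ⧸ 𝔭.asIdeal) := by
  symm
  refine Nat.card_eq_of_bijective (Ideal.quotientMap 𝔓.asIdeal f h.ge)
    ⟨Ideal.quotientMap_injective' h.le, fun y => ?_⟩
  obtain ⟨x, rfl⟩ := Ideal.Quotient.mk_surjective y
  obtain ⟨r, hr⟩ := hN x
  obtain ⟨u, hu⟩ := 𝔭.isMaximal.exists_inv h𝔭
  obtain ⟨i, hi, hui⟩ := hu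
  refine ⟨Ideal.Quotient.mk _ (u * r), ?_⟩
  rw [Ideal.quotientMap_mk, Ideal.Quotient.mk_eq_mk_iff_sub_mem]
  have hfi : f i ∈ 𝔓.asIdeal := by rwa [← h, Ideal.mem_comap] at hi
  have h1 : f u * N + f i = 1 := by simpa using congrArg f hui
  have h2 : f (u * r) - x = -(x * f i) := by
    rw [map_mul, hr]
    linear_combination x * h1
  rw [h2]
  exact neg_mem (Ideal.mul_mem_left _ _ hfi)

variable [Module.Finite ℤ S]

theorem ringHom_isIntegral : f.IsIntegral := by
  refine RingHom.IsIntegral.tower_top (algebraMap ℤ R) f ?_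
  rw [show f.comp (algebraMap ℤ R) = algebraMap ℤ S from Subsingleton.elim _ _]
  exact algebraMap_isIntegral_iff.mpr inferInstance

/-- Every maximal ideal of `S` lies above exactly one maximal ideal of `R`. -/
def sigmaAboveEquiv :
    (Σ 𝔭 : MaximalSpectrum R,
      {𝔓 : MaximalSpectrum S // Ideal.comap f 𝔓.asIdeal = 𝔭.asIdeal}) ≃ MaximalSpectrum S where
  toFun x := x.2.1
  invFun 𝔓 := ⟨⟨Ideal.comap f 𝔓.asIdeal,
    haveI := 𝔓.isMaximal
    Ideal.isMaximal_comap_of_isIntegral_of_isMaximal' f (ringHom_isIntegral f) 𝔓.asIdeal⟩, 𝔓, rfl⟩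
  left_inv := by
    rintro ⟨⟨I, hI⟩, 𝔓, h⟩
    dsimp only at h
    subst h
    rfl
  right_inv _ := rfl

theorem existsUnique_above {N : ℕ} (hf : Function.Injective f)
    (hN : ∀ x : S, ∃ r : R, f r = N * x) {𝔭 : MaximalSpectrum R} (h𝔭 : (N : R) ∉ 𝔭.asIdeal) :
    ∃! 𝔓 : MaximalSpectrum S, Ideal.comap f 𝔓.asIdeal = 𝔭.asIdeal := by
  let := f.toAlgebra
  have : Algebra.IsIntegral R S := algebraMap_isIntegral_iff.mp (ringHom_isIntegral f)
  have := 𝔭.isMaximal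
  obtain ⟨Q, hQ, hQ𝔭⟩ := Ideal.exists_ideal_over_maximal_of_isIntegral (S := S) 𝔭.asIdeal
    (by rw [(RingHom.injective_iff_ker_eq_bot (algebraMap R S)).mp hf]; exact bot_le)
  have key : ∀ 𝔓 : MaximalSpectrum S, Ideal.comap f 𝔓.asIdeal = 𝔭.asIdeal →
      ∀ x r, f r = N * x → (x ∈ 𝔓.asIdeal ↔ r ∈ 𝔭.asIdeal) := by
    intro 𝔓 h x r hr
    rw [← h, Ideal.mem_comap, hr]
    refine ⟨fun hx => Ideal.mul_mem_left _ _ hx, fun hx => ?_⟩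
    refine (𝔓.isMaximal.isPrime.mem_or_mem hx).resolve_left fun hmem => h𝔭 ?_
    rw [← h, Ideal.mem_comap, map_natCast]
    exact hmem
  refine ⟨⟨Q, hQ⟩, hQ𝔭, fun 𝔓 h => ?_⟩
  ext x
  obtain ⟨r, hr⟩ := hN x
  rw [key 𝔓 h x r hr, key ⟨Q, hQ⟩ hQ𝔭 x r hr]

variable [Module.Finite ℤ R]

theorem finite_above (𝔭 : MaximalSpectrum R) :
    Finite {𝔓 : MaximalSpectrum S // Ideal.comap f 𝔓.asIdeal = 𝔭.asIdeal} := by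
  obtain ⟨p, hp, hmem⟩ := exists_prime_natCast_mem 𝔭
  have : {𝔓 : MaximalSpectrum S | Ideal.comap f 𝔓.asIdeal = 𝔭.asIdeal}.Finite := by
    refine (finite_setOf_natCast_mem hp.pos).subset fun 𝔓 h𝔓 => ?_
    rw [← (h𝔓 : _ = _), Ideal.mem_comap] at hmem
    simpa using hmem
  exact this

theorem continuousAt_localZetaRatio (𝔭 : MaximalSpectrum R) :
    ContinuousAt (fun s => localZetaRatio f s 𝔭) 1 := by
  have := finite_above f 𝔭
  have := Fintype.ofFinite {𝔓 : MaximalSpectrum S // Ideal.comap f 𝔓.asIdeal = 𝔭.asIdeal}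
  unfold localZetaRatio
  refine ContinuousAt.div ?_ (continuousAt_eulerFactor 𝔭) ?_
  · simp only [tprod_fintype]
    exact tendsto_finsetProd _ fun 𝔓 _ => continuousAt_eulerFactor 𝔓.1
  · exact (zero_lt_one.trans_le (one_le_eulerFactor 𝔭 le_rfl)).ne'

theorem localZetaRatio_eq_one {N : ℕ} (hf : Function.Injective f)
    (hN : ∀ x : S, ∃ r : R, f r = N * x) {𝔭 : MaximalSpectrum R} (h𝔭 : (N : R) ∉ 𝔭.asIdeal)
    {s : ℝ} (hs : 1 ≤ s) : localZetaRatio f s 𝔭 = 1 := by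
  obtain ⟨𝔓, h𝔓, huniq⟩ := existsUnique_above f hf hN h𝔭
  let : Unique {𝔓 : MaximalSpectrum S // Ideal.comap f 𝔓.asIdeal = 𝔭.asIdeal} :=
    ⟨⟨⟨𝔓, h𝔓⟩⟩, fun x => Subtype.ext (huniq x.1 x.2)⟩
  have hprod : (∏' 𝔓 : {𝔓 : MaximalSpectrum S // Ideal.comap f 𝔓.asIdeal = 𝔭.asIdeal},
      (1 - (Nat.card (S ⧸ 𝔓.1.asIdeal) : ℝ) ^ (-s))⁻¹) =
      (1 - (Nat.card (R ⧸ 𝔭.asIdeal) : ℝ) ^ (-s))⁻¹ := by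
    rw [tprod_fintype, Fintype.prod_unique]
    change (1 - (Nat.card (S ⧸ 𝔓.asIdeal) : ℝ) ^ (-s))⁻¹ = _
    rw [card_quotient_eq_of_comap_eq f hN h𝔭 h𝔓]
  rw [localZetaRatio, hprod]
  exact div_self (zero_lt_one.trans_le (one_le_eulerFactor 𝔭 hs)).ne'

theorem zetaOrder_div_eq_prod_localZetaRatio {T : Finset (MaximalSpectrum R)} {s : ℝ}
    (hs : 1 < s) (hT : ∀ 𝔭 ∉ T, localZetaRatio f s 𝔭 = 1) :
    zetaOrder S s / zetaOrder R s = ∏ 𝔭 ∈ T, localZetaRatio f s 𝔭 := by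
  have hS := (sigmaAboveEquiv f).hasProd_iff.mpr (multipliable_eulerFactor (A := S) hs).hasProd
  have hS' := hS.sigma (g := fun 𝔭 =>
      ∏' 𝔓 : {𝔓 : MaximalSpectrum S // Ideal.comap f 𝔓.asIdeal = 𝔭.asIdeal},
        (1 - (Nat.card (S ⧸ 𝔓.1.asIdeal) : ℝ) ^ (-s))⁻¹) fun 𝔭 => by
    have := finite_above f 𝔭
    have := Fintype.ofFinite {𝔓 : MaximalSpectrum S // Ideal.comap f 𝔓.asIdeal = 𝔭.asIdeal}
    rw [tprod_fintype]
    exact hasProd_fintype _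
  have hR := (hasProd_prod_of_ne_finset_one hT).mul (multipliable_eulerFactor (A := R) hs).hasProd
  rw [div_eq_iff (zero_lt_one.trans_le (one_le_zetaOrder hs)).ne']
  refine hS'.unique (hR.congr_fun fun 𝔭 => ?_)
  exact (div_mul_cancel₀ _ (zero_lt_one.trans_le (one_le_eulerFactor 𝔭 hs.le)).ne').symm

theorem tendsto_zetaOrder_div {N : ℕ} (hN0 : 0 < N) (hf : Function.Injective f)
    (hN : ∀ x : S, ∃ r : R, f r = N * x) :
    Tendsto (fun s => zetaOrder S s / zetaOrder R s) (𝓝[>] 1)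
      (𝓝 (∏' 𝔭, localZetaRatio f 1 𝔭)) := by
  have hfin := finite_setOf_natCast_mem (A := R) hN0
  have hT : ∀ s : ℝ, 1 ≤ s → ∀ 𝔭 ∉ hfin.toFinset, localZetaRatio f s 𝔭 = 1 :=
    fun s hs 𝔭 h𝔭 => localZetaRatio_eq_one f hf hN (by simpa using h𝔭) hs
  rw [tprod_eq_prod (hT 1 le_rfl)]
  refine Tendsto.congr' (f₁ := fun s => ∏ 𝔭 ∈ hfin.toFinset, localZetaRatio f s 𝔭) ?_ ?_
  · filter_upwards [self_mem_nhdsWithin] with s hs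
    exact (zetaOrder_div_eq_prod_localZetaRatio f hs (hT s (le_of_lt hs))).symm
  · exact tendsto_finsetProd _ fun 𝔭 _ =>
      (continuousAt_localZetaRatio f 𝔭).tendsto.mono_left nhdsWithin_le_nhds

end Extension

end MaximalSpectrum

theorem finite_integralClosure_pi {ι : Type} [Finite ι] (K : ι → Type) [∀ i, Field (K i)]
    [∀ i, NumberField (K i)] : Module.Finite ℤ (integralClosure ℤ (Π i, K i)) := by
  let φ : integralClosure ℤ (Π i, K i) →+ Π i, 𝓞 (K i) :=
    { toFun := fun x i => ⟨x.1 i, x.2.map (Pi.evalAlgHom ℤ K i)⟩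
      map_zero' := rfl
      map_add' := fun _ _ => rfl }
  refine Module.Finite.of_injective φ.toIntLinearMap fun x y h => ?_
  ext i
  exact congrArg Subtype.val (congrFun h i)

theorem exists_pos_nsmul_mem_of_finite {V : Type} [AddCommGroup V] (B L : AddSubgroup V)
    [Module.Finite ℤ L] (h : ∀ x : V, ∃ n : ℕ, 0 < n ∧ n • x ∈ B) :
    ∃ N : ℕ, 0 < N ∧ ∀ x ∈ L, N • x ∈ B := by
  obtain ⟨n, φ, hφ⟩ := Module.Finite.exists_fin' ℤ L
  choose k hk hmem using h
  let e : Fin n → V := fun i => φ (Pi.single i 1)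
  refine ⟨∏ i, k (e i), Finset.prod_pos fun i _ => hk _, fun x hx => ?_⟩
  obtain ⟨v, hv⟩ := hφ ⟨x, hx⟩
  have hx' : x = ∑ i, v i • e i := by
    have : φ v = ∑ i, v i • φ (Pi.single i 1) := by
      conv_lhs => rw [← (Pi.basisFun ℤ (Fin n)).sum_repr v]
      simp only [map_sum, map_smul, Pi.basisFun_repr, Pi.basisFun_apply]
    rw [hv] at this
    simpa [e] using congrArg Subtype.val this
  rw [hx', Finset.smul_sum]
  refine sum_mem fun i _ => ?_
  rw [smul_comm]
  refine zsmul_mem ?_ _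
  rw [← Finset.prod_erase_mul _ _ (Finset.mem_univ i), mul_smul]
  exact nsmul_mem (hmem _) _

/-- As real `s → 1⁺`, the ratio `ζ_𝒪̃(s)/ζ_𝒪(s)` tends to
`∏_𝔭 [∏_{𝔓|𝔭} (1 - N𝔓⁻¹)⁻¹] / (1 - N𝔭⁻¹)⁻¹`. -/
theorem stmt5 {m : ℕ} (K : Fin m → Type) [∀ i, Field (K i)] [∀ i, NumberField (K i)]
    (O : Subalgebra ℤ (Π i, K i)) (hfg : Module.Finite ℤ ↥O)
    (hK : ∀ x : Π i, K i, ∃ n : ℕ, 0 < n ∧ n • x ∈ O)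
    (hle : O ≤ integralClosure ℤ (Π i, K i)) :
    Filter.Tendsto
      (fun s : ℝ => zetaOrder ↥(integralClosure ℤ (Π i, K i)) s / zetaOrder ↥O s)
      (nhdsWithin 1 (Set.Ioi 1))
      (nhds (∏' 𝔭 : MaximalSpectrum ↥O,
        (∏' 𝔓 : {𝔓 : MaximalSpectrum ↥(integralClosure ℤ (Π i, K i)) //
            Ideal.comap ((Subalgebra.inclusion hle).toRingHom :
              ↥O →+* ↥(integralClosure ℤ (Π i, K i))) 𝔓.asIdeal = 𝔭.asIdeal},
          (1 - (Nat.card (↥(integralClosure ℤ (Π i, K i)) ⧸ 𝔓.1.asIdeal) : ℝ)⁻¹)⁻¹) /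
        (1 - (Nat.card (↥O ⧸ 𝔭.asIdeal) : ℝ)⁻¹)⁻¹)) := by
  have : Module.Finite ℤ ↥(integralClosure ℤ (Π i, K i)) := finite_integralClosure_pi K
  have : Module.Finite ℤ ↥(integralClosure ℤ (Π i, K i)).toSubring.toAddSubgroup := this
  obtain ⟨N, hN0, hN⟩ := exists_pos_nsmul_mem_of_finite O.toSubring.toAddSubgroup
    (integralClosure ℤ (Π i, K i)).toSubring.toAddSubgroup hK
  have := MaximalSpectrum.tendsto_zetaOrder_div
    ((Subalgebra.inclusion hle).toRingHom : ↥O →+* ↥(integralClosure ℤ (Π i, K i))) hN0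
    (Subalgebra.inclusion_injective hle)
    fun x => ⟨⟨N • x.1, hN x.1 x.2⟩, Subtype.ext (nsmul_eq_mul N x.1)⟩
  simpa only [MaximalSpectrum.localZetaRatio, Real.rpow_neg_one] using this

end
end
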